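/- arXiv:2501.11736 — 2 statements merged into one kernel-verified Lean document; each statement's English description precedes it below -/
import Mathlib

section
/- Let p be a fixed odd prime and g a fixed positive integer. Then the limit L_o = lim_{k→∞} η_g(F_p^{2k+1}) / √(p^{2k+1}) exists and is a positive real number, where F_p^{2k+1} denotes the additive group of the (2k+1)-dimensional vector space over the field with p elements. -/
/-- `etaG g G` is the smallest cardinality of a `g`-difference basis of the abelian
group `G`: a finite set `A ⊆ G` such that for every `x ∈ G` there are at least `g`
ordered pairs `(a, a') ∈ A × A` with `a - a' = x`. -/
noncomputable def etaG (g : ℕ) (G : Type*) [AddCommGroup G] [DecidableEq G] : ℕ :=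
  sInf {k | ∃ A : Finset G, A.card = k ∧
    ∀ x : G, g ≤ ((A ×ˢ A).filter (fun p => p.1 - p.2 = x)).card}

/-- `A` is a `g`-difference basis: every `x` has at least `g` representations `x = a - a'` with
`a, a' ∈ A`, listed here through the first components `a`. -/
def IsDiffBasis {G : Type*} [AddCommGroup G] (g : ℕ) (A : Finset G) : Prop :=
  ∀ x : G, ∃ f : Fin g → G, Function.Injective f ∧ ∀ i, f i ∈ A ∧ f i - x ∈ A

theorem isDiffBasis_iff_le_card {G : Type*} [AddCommGroup G] [DecidableEq G] {g : ℕ}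
    {A : Finset G} :
    IsDiffBasis g A ↔ ∀ x : G, g ≤ ((A ×ˢ A).filter (fun p => p.1 - p.2 = x)).card := by
  refine forall_congr' fun x => ⟨?_, fun h => ?_⟩
  · rintro ⟨f, hf, hA⟩
    have h := Finset.card_le_card_of_injOn (s := (Finset.univ : Finset (Fin g)))
      (t := (A ×ˢ A).filter (fun p => p.1 - p.2 = x)) (fun i => (f i, f i - x))
      (fun i _ => by simp [hA i])
      (fun i _ j _ hij => hf (congrArg Prod.fst hij))
    simpa using h
  · obtain ⟨e⟩ : Nonempty (Fin g ↪ ((A ×ˢ A).filter (fun p => p.1 - p.2 = x))) :=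
      Function.Embedding.nonempty_of_card_le (by simpa using h)
    have he : ∀ i, ((e i).1.1 ∈ A ∧ (e i).1.2 ∈ A) ∧ (e i).1.1 - (e i).1.2 = x := fun i => by
      simpa only [Finset.mem_filter, Finset.mem_product] using (e i).2
    refine ⟨fun i => (e i).1.1, fun i j hij => e.injective (Subtype.ext (Prod.ext hij ?_)),
      fun i => ⟨(he i).1.1, ?_⟩⟩
    · have h1 := (he i).2.trans (he j).2.symm
      have h2 : (e i).1.1 = (e j).1.1 := hij
      rw [h2] at h1
      exact sub_right_injective h1
    · have h1 : (e i).1.1 - x = (e i).1.2 := by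
        rw [sub_eq_iff_eq_add, ← sub_eq_iff_eq_add']
        exact (he i).2
      exact h1 ▸ (he i).1.2

theorem IsDiffBasis.etaG_le {G : Type*} [AddCommGroup G] [DecidableEq G] {g : ℕ}
    {A : Finset G} (hA : IsDiffBasis g A) : etaG g G ≤ A.card :=
  Nat.sInf_le ⟨A, rfl, isDiffBasis_iff_le_card.1 hA⟩

theorem exists_isDiffBasis_card_eq_etaG {G : Type*} [AddCommGroup G] [Fintype G]
    [DecidableEq G] {g : ℕ} (hg : g ≤ Fintype.card G) :
    ∃ A : Finset G, IsDiffBasis g A ∧ A.card = etaG g G := by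
  have huniv : IsDiffBasis g (Finset.univ : Finset G) := fun x => by
    obtain ⟨e⟩ : Nonempty (Fin g ↪ G) :=
      Function.Embedding.nonempty_of_card_le (by simpa using hg)
    exact ⟨e, e.injective, fun i => by simp⟩
  obtain ⟨A, hc, hA⟩ := Nat.sInf_mem (s := {k | ∃ A : Finset G, A.card = k ∧
    ∀ x : G, g ≤ ((A ×ˢ A).filter (fun p => p.1 - p.2 = x)).card})
    ⟨_, Finset.univ, rfl, isDiffBasis_iff_le_card.1 huniv⟩
  exact ⟨A, isDiffBasis_iff_le_card.2 hA, hc⟩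

theorem IsDiffBasis.map {G H : Type*} [AddCommGroup G] [AddCommGroup H] {g : ℕ}
    {A : Finset G} (hA : IsDiffBasis g A) (e : G ≃+ H) :
    IsDiffBasis g (A.map e.toEquiv.toEmbedding) := by
  intro x
  obtain ⟨f, hf, hfA⟩ := hA (e.symm x)
  refine ⟨fun i => e (f i), e.injective.comp hf, fun i => ⟨?_, ?_⟩⟩
  · exact Finset.mem_map_of_mem e.toEquiv.toEmbedding (hfA i).1
  · have h := Finset.mem_map_of_mem e.toEquiv.toEmbedding (hfA i).2
    simpa using h

theorem IsDiffBasis.card_le_sq {G : Type*} [AddCommGroup G] [Fintype G] {g : ℕ} (hg : 0 < g)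
    {A : Finset G} (hA : IsDiffBasis g A) : Fintype.card G ≤ A.card ^ 2 := by
  classical
  have h : (Finset.univ : Finset G) ⊆ (A ×ˢ A).image (fun p => p.1 - p.2) := fun x _ => by
    obtain ⟨f, -, hf⟩ := hA x
    exact Finset.mem_image.2 ⟨(f ⟨0, hg⟩, f ⟨0, hg⟩ - x),
      Finset.mem_product.2 (hf ⟨0, hg⟩), sub_sub_cancel _ _⟩
  calc Fintype.card G ≤ ((A ×ˢ A).image (fun p => p.1 - p.2)).card := Finset.card_le_card h
    _ ≤ (A ×ˢ A).card := Finset.card_image_le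
    _ = A.card ^ 2 := by rw [Finset.card_product, sq]

theorem exists_isDiffBasis_prod (D H K : Type*) [AddCommGroup D] [AddCommGroup H]
    [AddCommGroup K] [Fintype D] [Fintype H] [Fintype K] {g : ℕ} (hg : g ≤ Fintype.card D) :
    ∃ A : Finset (D × H × K), IsDiffBasis g A ∧
      A.card ≤ Fintype.card D * Fintype.card H + Fintype.card D * Fintype.card K := by
  classical
  refine ⟨Finset.univ ×ˢ Finset.univ ×ˢ {0} ∪ Finset.univ ×ˢ {0} ×ˢ Finset.univ, ?_, ?_⟩
  · rintro ⟨d, h, k⟩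
    obtain ⟨e⟩ : Nonempty (Fin g ↪ D) :=
      Function.Embedding.nonempty_of_card_le (by simpa using hg)
    exact ⟨fun i => (e i, h, 0), fun i j hij => e.injective (congrArg Prod.fst hij),
      fun i => by simp⟩
  · refine (Finset.card_union_le _ _).trans_eq ?_
    simp [Finset.card_product]

/-- The parabola `{(s, s ^ 2)}` represents every `(a, b)` with `a ≠ 0` as a difference, so a basis
of `G × F × F` arises from its product with a basis of `G` by adding a basis of `G × {0} × F`. -/
theorem IsDiffBasis.exists_prod_field {G F : Type*} [AddCommGroup G] [Field F] [Fintype F]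
    (h2 : (2 : F) ≠ 0) {g : ℕ} {B : Finset G} (hB : IsDiffBasis g B)
    {C : Finset (G × F)} (hC : IsDiffBasis g C) :
    ∃ A : Finset (G × F × F), IsDiffBasis g A ∧ A.card ≤ B.card * Fintype.card F + C.card := by
  classical
  refine ⟨B ×ˢ Finset.univ.image (fun s : F => (s, s ^ 2)) ∪
    C.image (fun c => (c.1, 0, c.2)), ?_, ?_⟩
  · rintro ⟨x, a, b⟩
    by_cases ha : a = 0
    · subst ha
      obtain ⟨f, hf, hfC⟩ := hC (x, b)
      refine ⟨fun i => ((f i).1, 0, (f i).2), fun i j hij => hf ?_, fun i => ⟨?_, ?_⟩⟩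
      · simpa [Prod.ext_iff] using hij
      · exact Finset.mem_union_right _ (Finset.mem_image_of_mem _ (hfC i).1)
      · refine Finset.mem_union_right _ (Finset.mem_image.2 ⟨_, (hfC i).2, ?_⟩)
        simp
    · obtain ⟨f, hf, hfB⟩ := hB x
      refine ⟨fun i => (f i, (b / a + a) / 2, ((b / a + a) / 2) ^ 2),
        fun i j hij => hf (congrArg Prod.fst hij), fun i => ⟨?_, ?_⟩⟩
      · exact Finset.mem_union_left _ (Finset.mem_product.2
          ⟨(hfB i).1, Finset.mem_image_of_mem _ (Finset.mem_univ _)⟩)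
      · refine Finset.mem_union_left _ (Finset.mem_product.2
          ⟨(hfB i).2, Finset.mem_image.2 ⟨(b / a + a) / 2 - a, Finset.mem_univ _, ?_⟩⟩)
        refine Prod.ext rfl ?_
        change ((b / a + a) / 2 - a) ^ 2 = ((b / a + a) / 2) ^ 2 - b
        field_simp
        ring
  · refine (Finset.card_union_le _ _).trans (Nat.add_le_add ?_ Finset.card_image_le)
    rw [Finset.card_product]
    exact Nat.mul_le_mul_left _ Finset.card_image_le

theorem etaG_zmod_pi_le {p : ℕ} [Fact p.Prime] (hodd : Odd p) {g n m d h h' : ℕ} (hm : m ≠ 0)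
    (hn : g ≤ p ^ n) (hd : g ≤ p ^ d) (hdim : d + h + h' = n + m) :
    etaG g (Fin (n + 2 * m) → ZMod p) ≤
      etaG g (Fin n → ZMod p) * p ^ m + (p ^ d * p ^ h + p ^ d * p ^ h') := by
  classical
  let F := GaloisField p m
  have : Fintype F := Fintype.ofFinite F
  have hF : Fintype.card F = p ^ m := by
    rw [← Nat.card_eq_fintype_card]; exact GaloisField.card p m hm
  have hrank : Module.finrank (ZMod p) F = m := GaloisField.finrank p hm
  have h2 : (2 : F) ≠ 0 := by
    refine Ring.two_ne_zero ?_
    rw [ringChar.eq F p]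
    rintro rfl
    exact absurd hodd (by decide)
  obtain ⟨B, hB, hBc⟩ := exists_isDiffBasis_card_eq_etaG (G := Fin n → ZMod p) (g := g)
    (by simpa [ZMod.card] using hn)
  obtain ⟨C, hC, hCc⟩ := exists_isDiffBasis_prod (Fin d → ZMod p) (Fin h → ZMod p)
    (Fin h' → ZMod p) (g := g) (by simpa [ZMod.card] using hd)
  let e₁ : ((Fin d → ZMod p) × (Fin h → ZMod p) × (Fin h' → ZMod p)) ≃ₗ[ZMod p]
      ((Fin n → ZMod p) × F) := LinearEquiv.ofFinrankEq _ _ (by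
    simp only [Module.finrank_prod, Module.finrank_fin_fun, hrank]; omega)
  let e₂ : ((Fin n → ZMod p) × F × F) ≃ₗ[ZMod p] (Fin (n + 2 * m) → ZMod p) :=
    LinearEquiv.ofFinrankEq _ _ (by
      simp only [Module.finrank_prod, Module.finrank_fin_fun, hrank]; omega)
  obtain ⟨A, hA, hAc⟩ := hB.exists_prod_field h2 (hC.map e₁.toAddEquiv)
  have key := (hA.map e₂.toAddEquiv).etaG_le
  rw [Finset.card_map] at key hAc
  simp only [Fintype.card_pi, ZMod.card, Finset.prod_const, Finset.card_univ,
    Fintype.card_fin] at hCc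
  rw [hF, hBc] at hAc
  exact key.trans (hAc.trans (Nat.add_le_add_left hCc _))

theorem exists_pos_tendsto_of_le_add {a : ℕ → ℝ} {N : ℕ} {c : ℝ} (hc : 0 < c)
    (hlow : ∀ k ≥ N, c ≤ a k) (e : ℕ → ℝ) (he : Filter.Tendsto e Filter.atTop (nhds 0))
    (hup : ∀ k ≥ N, ∀ᶠ m in Filter.atTop, a (k + m) ≤ a k + e m) :
    ∃ L : ℝ, 0 < L ∧ Filter.Tendsto a Filter.atTop (nhds L) := by
  have hne : (a '' Set.Ici N).Nonempty := ⟨a N, N, Set.mem_Ici.2 le_rfl, rfl⟩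
  have hbdd : BddBelow (a '' Set.Ici N) := ⟨c, by rintro _ ⟨k, hk, rfl⟩; exact hlow k hk⟩
  refine ⟨sInf (a '' Set.Ici N), hc.trans_le
    (le_csInf hne (by rintro _ ⟨k, hk, rfl⟩; exact hlow k hk)), ?_⟩
  refine tendsto_order.2 ⟨fun b hb => ?_, fun b hb => ?_⟩
  · filter_upwards [Filter.eventually_ge_atTop N] with k hk
    exact hb.trans_le (csInf_le hbdd ⟨k, hk, rfl⟩)
  · obtain ⟨_, ⟨k, hk, rfl⟩, hkb⟩ := exists_lt_of_csInf_lt hne hb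
    have hev := (hup k hk).and (he.eventually_lt_const (sub_pos.2 hkb))
    obtain ⟨M, hM⟩ := Filter.eventually_atTop.1 hev
    filter_upwards [Filter.eventually_ge_atTop (k + M)] with j hj
    obtain ⟨h₁, h₂⟩ := hM (j - k) (by omega)
    rw [show k + (j - k) = j by omega] at h₁
    linarith

theorem etaG_odd_dim_div_sqrt_le {p : ℕ} [Fact p.Prime] (hodd : Odd p) {g k m d : ℕ}
    (hd : g ≤ p ^ d) (hk : d ≤ k) (hm : 2 * d + 2 ≤ m) :
    (etaG g (Fin (2 * (k + m) + 1) → ZMod p) : ℝ) / Real.sqrt ((p : ℝ) ^ (2 * (k + m) + 1)) ≤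
      (etaG g (Fin (2 * k + 1) → ZMod p) : ℝ) / Real.sqrt ((p : ℝ) ^ (2 * k + 1)) +
        2 * (p : ℝ) ^ (d + 1) * ((p : ℝ)⁻¹) ^ (m / 2) := by
  have hp1 : 1 ≤ p := (Fact.out : p.Prime).one_le
  have hp : (1 : ℝ) ≤ p := by exact_mod_cast hp1
  have hp0 : (0 : ℝ) < p := by linarith
  have key := etaG_zmod_pi_le (p := p) hodd (n := 2 * k + 1) (m := m) (d := d)
    (h := k + m / 2) (h' := k + 1 + (m - m / 2) - d) (by omega)
    (hd.trans (Nat.pow_le_pow_right hp1 (by omega))) hd (by omega)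
  rw [show 2 * k + 1 + 2 * m = 2 * (k + m) + 1 by ring, ← pow_add, ← pow_add] at key
  have h₁ : p ^ (d + (k + m / 2)) ≤ p ^ (d + 1 + k + (m - m / 2)) :=
    Nat.pow_le_pow_right hp1 (by omega)
  have h₂ : p ^ (d + (k + 1 + (m - m / 2) - d)) ≤ p ^ (d + 1 + k + (m - m / 2)) :=
    Nat.pow_le_pow_right hp1 (by omega)
  have key' : (etaG g (Fin (2 * (k + m) + 1) → ZMod p) : ℝ) ≤
      etaG g (Fin (2 * k + 1) → ZMod p) * (p : ℝ) ^ m +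
        2 * (p : ℝ) ^ (d + 1 + k + (m - m / 2)) := by
    exact_mod_cast key.trans (by omega)
  have hsplit : Real.sqrt ((p : ℝ) ^ (2 * (k + m) + 1)) =
      Real.sqrt ((p : ℝ) ^ (2 * k + 1)) * (p : ℝ) ^ m := by
    rw [show 2 * (k + m) + 1 = 2 * k + 1 + m * 2 by ring, pow_add, pow_mul,
      Real.sqrt_mul (by positivity), Real.sqrt_sq (by positivity)]
  have hk_le : (p : ℝ) ^ k ≤ Real.sqrt ((p : ℝ) ^ (2 * k + 1)) := by
    refine Real.le_sqrt_of_sq_le ?_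
    rw [← pow_mul]
    exact pow_le_pow_right₀ hp (by omega)
  have hs : 0 < Real.sqrt ((p : ℝ) ^ (2 * k + 1)) := by positivity
  rw [hsplit, div_le_iff₀ (by positivity)]
  refine key'.trans ?_
  rw [add_mul, ← mul_assoc, div_mul_cancel₀ _ hs.ne']
  refine add_le_add le_rfl ?_
  have hpm : (p : ℝ) ^ m = (p : ℝ) ^ (m / 2) * (p : ℝ) ^ (m - m / 2) := by
    rw [← pow_add]; congr 1; omega
  calc 2 * (p : ℝ) ^ (d + 1 + k + (m - m / 2))
      = 2 * (p : ℝ) ^ (d + 1) * ((p : ℝ)⁻¹) ^ (m / 2) * ((p : ℝ) ^ k * (p : ℝ) ^ m) := by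
        rw [hpm, inv_pow, pow_add _ (d + 1 + k), pow_add _ (d + 1)]
        field_simp
    _ ≤ _ := by gcongr

theorem stmt14 (p : ℕ) (hp : p.Prime) (hodd : Odd p) (g : ℕ) (hg : 0 < g) :
    ∃ L : ℝ, 0 < L ∧
      Filter.Tendsto
        (fun k : ℕ =>
          (etaG g (Fin (2 * k + 1) → ZMod p) : ℝ) / Real.sqrt ((p : ℝ) ^ (2 * k + 1)))
        Filter.atTop (nhds L) := by
  have : Fact p.Prime := ⟨hp⟩
  have hgp : g ≤ p ^ g := (Nat.lt_pow_self hp.one_lt).le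
  have hp0 : (0 : ℝ) < p := by exact_mod_cast hp.pos
  refine exists_pos_tendsto_of_le_add (N := g) one_pos (fun k hk => ?_)
    (fun m => 2 * (p : ℝ) ^ (g + 1) * ((p : ℝ)⁻¹) ^ (m / 2)) ?_ (fun k hk => ?_)
  · obtain ⟨A, hA, hAc⟩ := exists_isDiffBasis_card_eq_etaG (G := Fin (2 * k + 1) → ZMod p)
      (g := g) (by simpa [ZMod.card] using hgp.trans (Nat.pow_le_pow_right hp.pos (by omega)))
    have hcard := hA.card_le_sq hg
    rw [hAc] at hcard
    simp only [Fintype.card_pi, ZMod.card, Finset.prod_const, Finset.card_univ,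
      Fintype.card_fin] at hcard
    rw [one_le_div (by positivity)]
    exact Real.sqrt_le_left (Nat.cast_nonneg _) |>.2 (by exact_mod_cast hcard)
  · have hgeo := (tendsto_pow_atTop_nhds_zero_of_lt_one (inv_nonneg.2 hp0.le)
      (inv_lt_one_of_one_lt₀ (by exact_mod_cast hp.one_lt : (1 : ℝ) < p))).comp
      (Nat.tendsto_div_const_atTop two_ne_zero)
    simpa using hgeo.const_mul (2 * (p : ℝ) ^ (g + 1))
  · filter_upwards [Filter.eventually_ge_atTop (2 * g + 2)] with m hm
    exact etaG_odd_dim_div_sqrt_le hodd hgp hk hm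
end

section
/- Let g be a fixed positive integer. Then α_g(n) ≤ (1 + o(1))·√(gn) as n → ∞; that is, for every ε > 0 there exists N such that for all n ≥ N, α_g(n) ≤ (1 + ε)·√(gn). -/
/-- `alpha g n` is the largest cardinality of a subset `A ⊆ {1, …, n}` such that for
every nonzero integer `x` there are at most `g` ordered pairs `(a₁, a₂) ∈ A × A`
with `a₁ - a₂ = x`. -/
noncomputable def alpha (g n : ℕ) : ℕ :=
  sSup {k | ∃ A : Finset ℤ, A ⊆ Finset.Icc (1 : ℤ) (n : ℤ) ∧ A.card = k ∧
    ∀ x : ℤ, x ≠ 0 → ((A ×ˢ A).filter (fun p => p.1 - p.2 = x)).card ≤ g}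

open scoped Pointwise

/-- If every nonzero difference has at most `g` representations in `A`, then the additive energy
of `A` and `S` is at most `|S| |A| + g |S|²`. -/
theorem addEnergy_le_of_card_sub_le {g : ℕ} {A : Finset ℤ}
    (hA : ∀ x : ℤ, x ≠ 0 → ((A ×ˢ A).filter (fun p => p.1 - p.2 = x)).card ≤ g)
    (S : Finset ℤ) :
    A.addEnergy S ≤ S.card * A.card + g * S.card ^ 2 := by
  have hfiber : ∀ q ∈ S ×ˢ S,
      ((A ×ˢ A).filter (fun p => p.1 - p.2 = q.2 - q.1)).card
        ≤ (if q.1 = q.2 then A.card else 0) + g := by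
    intro q _
    split_ifs with h
    · refine le_trans ?_ (Nat.le_add_right _ _)
      refine Finset.card_le_card_of_injOn Prod.fst ?_ ?_
      · intro p hp
        simp only [Finset.coe_filter, Finset.mem_product, Set.mem_ofPred_eq] at hp
        exact hp.1.1
      · intro p hp p' hp' hpp
        simp only [Finset.coe_filter, Finset.mem_product, Set.mem_ofPred_eq] at hp hp'
        ext <;> omega
    · rw [zero_add]
      exact hA _ (fun h0 => h (by omega))
  have hdiag : ∑ q ∈ S ×ˢ S, (if q.1 = q.2 then A.card else 0) = S.card * A.card := by
    rw [Finset.sum_product]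
    simp
  have henergy : A.addEnergy S =
      ∑ q ∈ S ×ˢ S, ((A ×ˢ A).filter (fun p => p.1 - p.2 = q.2 - q.1)).card := by
    simp only [Finset.addEnergy, Finset.card_filter]
    rw [Finset.sum_product_right]
    refine Finset.sum_congr rfl fun q _ => Finset.sum_congr rfl fun p _ => ?_
    congr 1
    apply propext
    constructor <;> intro h <;> dsimp only at * <;> omega
  calc A.addEnergy S
      ≤ ∑ q ∈ S ×ˢ S, ((if q.1 = q.2 then A.card else 0) + g) :=
        henergy.le.trans (Finset.sum_le_sum hfiber)
    _ = S.card * A.card + g * S.card ^ 2 := by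
        rw [Finset.sum_add_distrib, hdiag, Finset.sum_const, Finset.card_product, smul_eq_mul]
        ring

theorem card_sq_mul_le {g n : ℕ} {A : Finset ℤ} (hsub : A ⊆ Finset.Icc (1 : ℤ) (n : ℤ))
    (hA : ∀ x : ℤ, x ≠ 0 → ((A ×ˢ A).filter (fun p => p.1 - p.2 = x)).card ≤ g)
    {u : ℕ} (hu : 0 < u) :
    A.card ^ 2 * u ≤ (n + u) * (A.card + g * u) := by
  have hcard : (Finset.Ico (0 : ℤ) u).card = u := by simp
  have hsum : (A + Finset.Ico (0 : ℤ) u).card ≤ n + u := by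
    have hss : A + Finset.Ico (0 : ℤ) u ⊆ Finset.Ico (0 : ℤ) ((n + u : ℕ) : ℤ) := by
      intro x hx
      obtain ⟨a, ha, s, hs, rfl⟩ := Finset.mem_add.mp hx
      have ha' := Finset.mem_Icc.mp (hsub ha)
      rw [Finset.mem_Ico] at hs ⊢
      push_cast
      omega
    have h := Finset.card_le_card hss
    rwa [Int.card_Ico, sub_zero, Int.toNat_natCast] at h
  have hE := addEnergy_le_of_card_sub_le hA (Finset.Ico (0 : ℤ) u)
  have hCS := Finset.le_card_add_mul_addEnergy A (Finset.Ico (0 : ℤ) u)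
  rw [hcard] at hE hCS
  refine Nat.le_of_mul_le_mul_left ?_ hu
  calc u * (A.card ^ 2 * u) = A.card ^ 2 * u ^ 2 := by ring
    _ ≤ (n + u) * (u * A.card + g * u ^ 2) := hCS.trans (Nat.mul_le_mul hsum hE)
    _ = u * ((n + u) * (A.card + g * u)) := by ring

theorem exists_card_eq_alpha (g n : ℕ) :
    ∃ A : Finset ℤ, A ⊆ Finset.Icc (1 : ℤ) (n : ℤ) ∧ A.card = alpha g n ∧
      ∀ x : ℤ, x ≠ 0 → ((A ×ˢ A).filter (fun p => p.1 - p.2 = x)).card ≤ g := by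
  refine Nat.sSup_mem (s := {k | ∃ A : Finset ℤ, A ⊆ Finset.Icc (1 : ℤ) (n : ℤ) ∧ A.card = k ∧
    ∀ x : ℤ, x ≠ 0 → ((A ×ˢ A).filter (fun p => p.1 - p.2 = x)).card ≤ g}) ?_ ?_
  · exact ⟨0, ∅, by simp, by simp, by simp⟩
  · refine ⟨n, ?_⟩
    rintro k ⟨A, hsub, rfl, -⟩
    simpa using Finset.card_le_card hsub

theorem alpha_sq_mul_le (g n : ℕ) {u : ℕ} (hu : 0 < u) :
    alpha g n ^ 2 * u ≤ (n + u) * (alpha g n + g * u) := by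
  obtain ⟨A, hsub, hcard, hA⟩ := exists_card_eq_alpha g n
  exact hcard ▸ card_sq_mul_le hsub hA hu

theorem stmt16 (g : ℕ) (hg : 0 < g) :
    ∀ ε : ℝ, 0 < ε → ∃ N : ℕ, ∀ n : ℕ, N ≤ n →
      (alpha g n : ℝ) ≤ (1 + ε) * Real.sqrt (g * n) := by
  intro ε hε
  obtain ⟨N, hN⟩ := exists_nat_ge (max (2 / ε) ((2 * (1 + ε) / ε ^ 2) ^ 2))
  refine ⟨N, fun n hn => ?_⟩
  have hNn : (N : ℝ) ≤ n := by exact_mod_cast hn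
  have hn1 : 2 / ε ≤ (n : ℝ) := (le_max_left _ _).trans (hN.trans hNn)
  have hn2 : (2 * (1 + ε) / ε ^ 2) ^ 2 ≤ (n : ℝ) := (le_max_right _ _).trans (hN.trans hNn)
  have hn0 : (0 : ℝ) < n := lt_of_lt_of_le (by positivity) hn1
  have hg1 : (1 : ℝ) ≤ g := by exact_mod_cast hg
  set s := Real.sqrt (g * n) with hs
  have hss : s ^ 2 = g * n := Real.sq_sqrt (by positivity)
  have hs1 : 2 * (1 + ε) / ε ^ 2 ≤ s := by
    refine Real.le_sqrt_of_sq_le (hn2.trans ?_)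
    nlinarith
  by_contra! hlt
  set k : ℝ := (alpha g n : ℝ) with hk
  have hs0 : 0 < s := lt_of_lt_of_le (by positivity) hs1
  have hk0 : 0 < k := lt_trans (by positivity) hlt
  obtain ⟨u, hu⟩ : ∃ u : ℕ, u = ⌈ε / 2 * n⌉₊ := ⟨_, rfl⟩
  have hul : ε / 2 * n ≤ u := hu ▸ Nat.le_ceil _
  have huu : (u : ℝ) < ε / 2 * n + 1 := hu ▸ Nat.ceil_lt_add_one (by positivity)
  have hu0 : (0 : ℝ) < u := lt_of_lt_of_le (by positivity) hul
  have hone : 1 ≤ ε / 2 * n := by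
    rw [div_le_iff₀ hε] at hn1
    linarith
  have hnu : (n : ℝ) + u ≤ (1 + ε) * n := by linarith
  have hmain : k ^ 2 * u ≤ (n + u) * (k + g * u) := by
    have := alpha_sq_mul_le g n (u := u) (by exact_mod_cast hu0)
    rw [hk]
    exact_mod_cast this
  have hbound : k ^ 2 ≤ (1 + ε) * (2 / ε * k + s ^ 2) := by
    refine le_of_mul_le_mul_right ?_ hu0
    have hnle : (n : ℝ) ≤ 2 / ε * u := by
      rw [div_mul_eq_mul_div, le_div_iff₀ hε]
      linarith
    calc k ^ 2 * u ≤ (n + u) * (k + g * u) := hmain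
      _ ≤ ((1 + ε) * n) * (k + g * u) := by gcongr
      _ = (1 + ε) * (n * k + s ^ 2 * u) := by rw [hss]; ring
      _ ≤ (1 + ε) * ((2 / ε * u) * k + s ^ 2 * u) := by gcongr
      _ = (1 + ε) * (2 / ε * k + s ^ 2) * u := by ring
  have hsk : (1 + ε) * s ^ 2 ≤ s * k := by nlinarith
  have hlin : k ≤ (1 + ε) * (2 / ε) + s := by
    refine le_of_mul_le_mul_right ?_ hk0
    nlinarith
  have hεs : (1 + ε) * (2 / ε) ≤ ε * s := by
    calc (1 + ε) * (2 / ε) = ε * (2 * (1 + ε) / ε ^ 2) := by field_simp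
      _ ≤ ε * s := by gcongr
  linarith
end
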